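/- arXiv:1109.2080 — 2 statements merged into one kernel-verified Lean document; each statement's English description precedes it below -/
import Mathlib

section
/- Let A : ℝ → ℂ^{n×n} be a matrix-valued function such that every entry of A is a real-analytic function of ω and A(ω) is Hermitian (A(ω) = A(ω)*) for every ω ∈ ℝ. Then there exist real-analytic functions λ̃₁, …, λ̃ₙ : ℝ → ℝ such that for every ω ∈ ℝ the characteristic polynomial of A(ω) factors as det(λI − A(ω)) = ∏_{j=1}^{n} (λ − λ̃ⱼ(ω)); i.e., the n roots of the characteristic polynomial of A(ω), counted with multiplicity, can be arranged so that each root is an analytic function of ω on all of ℝ. -/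
open Polynomial Matrix

namespace Rellich
open Filter Topology

/-- coefficientwise analyticity of a polynomial family -/
def AC {R : Type*} [NormedRing R] [NormedAlgebra ℝ R] (P : ℝ → R[X]) (x : ℝ) : Prop :=
  ∀ k, AnalyticAt ℝ (fun t => (P t).coeff k) x

noncomputable def toP (k : ℕ) : (Fin k → ℝ) →ₗ[ℝ] ℝ[X] :=
  ∑ j : Fin k, (monomial (j : ℕ)) ∘ₗ LinearMap.proj j

noncomputable def ofP (k : ℕ) : ℝ[X] →ₗ[ℝ] (Fin k → ℝ) :=
  LinearMap.pi fun i => lcoeff ℝ (i : ℕ)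

lemma toP_apply (k : ℕ) (u : Fin k → ℝ) : toP k u = ∑ j : Fin k, C (u j) * X ^ (j : ℕ) := by
  simp [toP, C_mul_X_pow_eq_monomial]

lemma toP_coeff (k : ℕ) (u : Fin k → ℝ) (i : ℕ) :
    (toP k u).coeff i = if h : i < k then u ⟨i, h⟩ else 0 := by
  rw [toP_apply, finsetSum_coeff]
  simp only [coeff_C_mul, coeff_X_pow]
  split_ifs with h
  · rw [Finset.sum_eq_single ⟨i, h⟩] <;> simp
    intro b hb hib
    exact absurd (Fin.ext hib.symm) hb
  · apply Finset.sum_eq_zero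
    intro b _
    have : i ≠ b := by have := b.2; omega
    simp [this]

lemma toP_degree (k : ℕ) (u : Fin k → ℝ) : (toP k u).degree < k := by
  rw [toP_apply]; exact degree_sum_fin_lt u

lemma toP_ofP (k : ℕ) (p : ℝ[X]) (h : p.degree < k) : toP k (ofP k p) = p := by
  ext i
  rw [toP_coeff]
  split_ifs with hi
  · simp [ofP]
  · exact (coeff_eq_zero_of_degree_lt (h.trans_le (by exact_mod_cast not_lt.1 hi))).symm

lemma toP_inj (k : ℕ) (u : Fin k → ℝ) (h : toP k u = 0) : u = 0 := by
  ext i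
  have := congrArg (fun p => p.coeff (i:ℕ)) h
  simpa [toP_coeff] using this

lemma monic_X_pow_add' (k : ℕ) (u : Fin k → ℝ) : (X ^ k + toP k u).Monic :=
  monic_X_pow_add (toP_degree k u)

lemma natDegree_X_pow_add' (k : ℕ) (u : Fin k → ℝ) : (X ^ k + toP k u).natDegree = k := by
  have : (X ^ k + toP k u).degree = (k : WithBot ℕ) := by
    rw [degree_add_eq_left_of_degree_lt] <;> rw [degree_X_pow]; exact toP_degree k u
  exact natDegree_eq_of_degree_eq_some this

lemma X_pow_add_ofP (k : ℕ) (p : ℝ[X]) (hm : p.Monic) (hd : p.natDegree = k) :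
    X ^ k + toP k (ofP k p) = p := by
  ext i
  rw [coeff_add, toP_coeff, coeff_X_pow]
  rcases lt_trichotomy i k with h | h | h
  · simp [h, h.ne, ofP]
  · subst h; simp [← hd, hm.coeff_natDegree]
  · rw [coeff_eq_zero_of_natDegree_lt (p := p) (by omega)]
    simp [h.ne', h.le]

lemma AC_toP {k : ℕ} {u : ℝ → Fin k → ℝ} {x : ℝ} (hu : AnalyticAt ℝ u x) :
    AC (fun t => X ^ k + toP k (u t)) x := by
  intro i
  simp only [coeff_add, toP_coeff]
  refine analyticAt_const.add ?_
  split_ifs with h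
  · exact (ContinuousLinearMap.proj (R := ℝ) (φ := fun _ : Fin k => ℝ) ⟨i, h⟩).analyticAt _ |>.comp hu
  · exact analyticAt_const

noncomputable def bil (k m N : ℕ) : (Fin k → ℝ) →ₗ[ℝ] (Fin m → ℝ) →ₗ[ℝ] (Fin N → ℝ) :=
  (((LinearMap.mul ℝ ℝ[X]).compl₁₂ (toP k) (toP m)).compr₂ (ofP N))

noncomputable def Phi (k m : ℕ) (w : (Fin k → ℝ) × (Fin m → ℝ)) : Fin (k + m) → ℝ :=
  ofP (k + m) ((X ^ k + toP k w.1) * (X ^ m + toP m w.2))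

noncomputable def linA (k m : ℕ) (p q : ℝ[X]) :
    ((Fin k → ℝ) × (Fin m → ℝ)) →ₗ[ℝ] (Fin (k + m) → ℝ) :=
  ofP (k + m) ∘ₗ ((LinearMap.mulRight ℝ q) ∘ₗ toP k ∘ₗ LinearMap.fst ℝ _ _ +
    (LinearMap.mulLeft ℝ p) ∘ₗ toP m ∘ₗ LinearMap.snd ℝ _ _)

lemma Phi_eq (k m : ℕ) : Phi k m = fun w => ofP (k+m) (X ^ k * X ^ m) +
    ((linA k m (X^k) (X^m)).toContinuousLinearMap w +
      (bil k m (k+m)).toContinuousBilinearMap w.1 w.2) := by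
  ext1 w
  simp only [Phi, linA, bil, LinearMap.coe_toContinuousLinearMap',
    LinearMap.toContinuousBilinearMap_apply]
  simp only [LinearMap.comp_apply, LinearMap.add_apply, LinearMap.mulRight_apply,
    LinearMap.mulLeft_apply, LinearMap.compr₂_apply, LinearMap.compl₁₂_apply,
    LinearMap.mul_apply', LinearMap.fst_apply, LinearMap.snd_apply, ← map_add]
  congr 1; ring

lemma Phi_contDiff (k m : ℕ) (w) : ContDiffAt ℝ ⊤ (Phi k m) w := by
  rw [Phi_eq]
  refine AnalyticAt.contDiffAt ?_
  refine analyticAt_const.add (AnalyticAt.add (ContinuousLinearMap.analyticAt _ _) ?_)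
  exact ((bil k m (k+m)).toContinuousBilinearMap).analyticAt_bilinear w

lemma Phi_hasFDerivAt (k m : ℕ) (w) : HasFDerivAt (Phi k m)
    (linA k m (X^k + toP k w.1) (X^m + toP m w.2)).toContinuousLinearMap w := by
  have h1 := ((bil k m (k+m)).toContinuousBilinearMap).isBoundedBilinearMap.hasFDerivAt w
  have h2 := ((linA k m (X^k) (X^m)).toContinuousLinearMap).hasFDerivAt (x := w)
  have h3 := (h2.add h1).const_add (ofP (k+m) (X ^ k * X ^ m))
  rw [Phi_eq]
  refine h3.congr_fderiv ?_
  refine ContinuousLinearMap.ext fun v => ?_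
  simp [linA, bil, add_mul, mul_add]
  ring
 
lemma linA_inj (k m : ℕ) (p q : ℝ[X]) (hp : p.Monic) (hq : q.Monic) (hk : p.natDegree = k)
    (hm : q.natDegree = m) (hc : IsCoprime p q) : Function.Injective (linA k m p q) := by
  rw [injective_iff_map_eq_zero]
  rintro ⟨u, v⟩ h
  have h' : ofP (k+m) (toP k u * q + p * toP m v) = 0 := by simpa [linA] using h
  have hpd : p.degree = k := by rw [degree_eq_natDegree hp.ne_zero, hk]
  have hqd : q.degree = m := by rw [degree_eq_natDegree hq.ne_zero, hm]
  have hd : (toP k u * q + p * toP m v).degree < (k + m : ℕ) := by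
    refine (degree_add_le _ _).trans_lt (max_lt ?_ ?_)
    · rw [degree_mul, hqd, Nat.cast_add]
      exact WithBot.add_lt_add_right (by simp) (toP_degree k u)
    · rw [degree_mul, hpd, Nat.cast_add]
      exact WithBot.add_lt_add_left (by simp) (toP_degree m v)
  have h0 := toP_ofP _ _ hd
  rw [h', map_zero] at h0
  have h1 : p ∣ toP k u * q := ⟨-toP m v, by linear_combination -h0⟩
  have h2 : p ∣ toP k u := hc.dvd_of_dvd_mul_right h1
  have h3 : toP k u = 0 := eq_zero_of_dvd_of_degree_lt h2 (by rw [hpd]; exact toP_degree k u)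
  have h4 : toP m v = 0 := by
    rw [h3, zero_mul, zero_add] at h0
    exact (mul_eq_zero.1 h0.symm).resolve_left hp.ne_zero
  simp [toP_inj _ _ h3, toP_inj _ _ h4]

lemma hensel (Q : ℝ → ℝ[X]) (x : ℝ) (p q : ℝ[X]) (hp : p.Monic) (hq : q.Monic)
    (hc : IsCoprime p q) (h0 : Q x = p * q) (hm : ∀ t, (Q t).Monic)
    (hd : ∀ t, (Q t).natDegree = p.natDegree + q.natDegree) (hA : AC Q x) :
    ∃ U V : ℝ → ℝ[X], (∀ t, (U t).Monic) ∧ (∀ t, (V t).Monic) ∧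
      (∀ t, (U t).natDegree = p.natDegree) ∧ (∀ t, (V t).natDegree = q.natDegree) ∧
      AC U x ∧ AC V x ∧ ∀ᶠ t in 𝓝 x, Q t = U t * V t := by
  obtain ⟨k, hk⟩ : ∃ k, p.natDegree = k := ⟨_, rfl⟩
  obtain ⟨m, hmm⟩ : ∃ m, q.natDegree = m := ⟨_, rfl⟩
  rw [hk, hmm]
  simp only [hk, hmm] at hd
  let w : (Fin k → ℝ) × (Fin m → ℝ) := (ofP k p, ofP m q)
  have hw1 : X ^ k + toP k w.1 = p := X_pow_add_ofP k p hp hk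
  have hw2 : X ^ m + toP m w.2 = q := X_pow_add_ofP m q hq hmm
  have hinj := linA_inj k m p q hp hq hk hmm hc
  let e : ((Fin k → ℝ) × (Fin m → ℝ)) ≃L[ℝ] (Fin (k + m) → ℝ) :=
    (LinearEquiv.ofInjectiveOfFinrankEq (linA k m p q) hinj (by simp)).toContinuousLinearEquiv
  have hder : HasFDerivAt (Phi k m) (e : _ →L[ℝ] _) w := by
    have := Phi_hasFDerivAt k m w
    rw [hw1, hw2] at this
    refine this.congr_fderiv ?_
    ext1 <;> rfl
  have hcd := Phi_contDiff k m w
  have htop : (⊤ : WithTop ℕ∞) ≠ 0 := by simp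
  let W := hcd.localInverse hder htop
  have hW : AnalyticAt ℝ W (Phi k m w) := (hcd.to_localInverse hder htop).analyticAt
  have hWr : ∀ᶠ y in 𝓝 (Phi k m w), Phi k m (W y) = y :=
    (hcd.hasStrictFDerivAt' hder htop).eventually_right_inverse
  have hPw : Phi k m w = ofP (k+m) (Q x) := by rw [Phi, hw1, hw2, h0]
  have hQa : AnalyticAt ℝ (fun t => ofP (k+m) (Q t)) x := by
    refine AnalyticAt.pi fun i => ?_
    exact hA i
  rw [hPw] at hW hWr
  have hWQ : AnalyticAt ℝ (fun t => W (ofP (k+m) (Q t))) x :=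
    AnalyticAt.comp (g := W) (f := fun t => ofP (k+m) (Q t)) hW hQa
  refine ⟨fun t => X ^ k + toP k (W (ofP (k+m) (Q t))).1,
    fun t => X ^ m + toP m (W (ofP (k+m) (Q t))).2, fun t => monic_X_pow_add' _ _,
    fun t => monic_X_pow_add' _ _, fun t => natDegree_X_pow_add' _ _,
    fun t => natDegree_X_pow_add' _ _, AC_toP (analyticAt_fst.comp hWQ),
    AC_toP (analyticAt_snd.comp hWQ), ?_⟩
  filter_upwards [hQa.continuousAt.eventually hWr] with t ht
  set u := W (ofP (k+m) (Q t))
  rw [← X_pow_add_ofP (k+m) (Q t) (hm t) (hd t), ← ht, Phi]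
  refine X_pow_add_ofP (k+m) _ ((monic_X_pow_add' _ _).mul (monic_X_pow_add' _ _)) ?_
  rw [(monic_X_pow_add' _ _).natDegree_mul (monic_X_pow_add' _ _), natDegree_X_pow_add',
    natDegree_X_pow_add']

end Rellich
namespace Rellich
open Filter Topology

section AC
variable {R : Type*} [NormedCommRing R] [NormedAlgebra ℝ R] {P Q : ℝ → R[X]} {x : ℝ}

lemma AC_const (p : R[X]) : AC (fun _ => p) x := fun _ => analyticAt_const

lemma AC_C {f : ℝ → R} (hf : AnalyticAt ℝ f x) : AC (fun t => C (f t)) x := by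
  intro k
  simp only [coeff_C]
  split_ifs
  · exact hf
  · exact analyticAt_const

lemma AC.add (hP : AC P x) (hQ : AC Q x) : AC (fun t => P t + Q t) x := by
  intro k
  simp only [coeff_add]
  exact (hP k).add (hQ k)

lemma AC.mul (hP : AC P x) (hQ : AC Q x) : AC (fun t => P t * Q t) x := by
  intro k
  simp only [coeff_mul]
  exact Finset.analyticAt_fun_sum _ fun i _ => (hP i.1).mul (hQ i.2)

lemma AC.pow (hP : AC P x) (n : ℕ) : AC (fun t => P t ^ n) x := by
  induction n with
  | zero => simpa using AC_const (x := x) (1 : R[X])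
  | succ n ih => simp only [pow_succ]; exact ih.mul hP

lemma AC_sum {ι : Type*} (s : Finset ι) {F : ι → ℝ → R[X]} (h : ∀ i ∈ s, AC (F i) x) :
    AC (fun t => ∑ i ∈ s, F i t) x := by
  intro k
  simp only [finsetSum_coeff]
  exact Finset.analyticAt_fun_sum _ fun i hi => h i hi k

lemma AC_prod {ι : Type*} (s : Finset ι) {F : ι → ℝ → R[X]} (h : ∀ i ∈ s, AC (F i) x) :
    AC (fun t => ∏ i ∈ s, F i t) x := by
  classical
  induction s using Finset.induction_on with
  | empty => simpa using AC_const (x := x) (1 : R[X])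
  | insert a s ha ih =>
    simp only [Finset.prod_insert ha]
    exact (h a (by simp)).mul (ih fun i hi => h i (by simp [hi]))
end AC

lemma AC_comp {P : ℝ → ℝ[X]} {x : ℝ} {n : ℕ} (hP : AC P x) (hd : ∀ t, (P t).natDegree = n)
    {c : ℝ → ℝ} (hc : AnalyticAt ℝ c x) : AC (fun t => (P t).comp (X + C (c t))) x := by
  have : (fun t => (P t).comp (X + C (c t))) =
      fun t => ∑ i ∈ Finset.range (n + 1), C ((P t).coeff i) * (X + C (c t)) ^ i := by
    ext1 t
    rw [Polynomial.comp, eval₂_eq_sum_range, hd]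
  rw [this]
  exact AC_sum _ fun i _ => (AC_C (hP i)).mul (((AC_const X).add (AC_C hc)).pow i)

lemma sumsq (s : Multiset ℝ) : (s.map (fun r => r ^ 2)).sum = s.sum ^ 2 - 2 * s.esymm 2 := by
  have h1 : ∀ s : Multiset ℝ, s.esymm 1 = s.sum := by
    intro s; simp [Multiset.esymm, Multiset.powersetCard_one]
  induction s using Multiset.induction_on with
  | empty => simp [Multiset.esymm, Multiset.powersetCard_zero_right 1]
  | cons a s ih =>
    have : (a ::ₘ s).esymm 2 = s.esymm 2 + a * s.esymm 1 := by
      simp [Multiset.esymm, Multiset.powersetCard_cons, Multiset.sum_map_mul_left]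
    rw [this, h1]
    simp only [Multiset.map_cons, Multiset.sum_cons, ih]
    ring

lemma roots_sumsq {p : ℝ[X]} {n : ℕ} (hm : p.Monic) (hd : p.natDegree = n) (hn : 2 ≤ n)
    (hs : p.Splits) (h0 : p.coeff (n - 1) = 0) :
    (p.roots.map (fun r => r ^ 2)).sum = - 2 * p.coeff (n - 2) := by
  have hcard : p.roots.card = n := by rw [← hs.natDegree_eq_card_roots, hd]
  have hp := hs.eq_prod_roots_of_monic hm
  have h1 := Multiset.prod_X_sub_C_coeff p.roots (k := n - 1) (by omega)
  have h2 := Multiset.prod_X_sub_C_coeff p.roots (k := n - 2) (by omega)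
  rw [← hp, hcard] at h1 h2
  rw [show n - (n - 1) = 1 by omega] at h1
  rw [show n - (n - 2) = 2 by omega] at h2
  have h3 : p.roots.esymm 1 = p.roots.sum := by
    simp [Multiset.esymm, Multiset.powersetCard_one]
  rw [sumsq, h2, ← h3]
  rw [h0] at h1
  have : p.roots.esymm 1 = 0 := by simpa using h1.symm
  rw [this]; ring

lemma coeff_bound {p : ℝ[X]} {n : ℕ} (hm : p.Monic) (hd : p.natDegree = n) (hn : 2 ≤ n)
    (hs : p.Splits) (h0 : p.coeff (n - 1) = 0) :
    0 ≤ - 2 * p.coeff (n - 2) ∧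
    ∀ i, |p.coeff i| ≤ Real.sqrt (- 2 * p.coeff (n - 2)) ^ (n - i) * n.choose i := by
  rw [← roots_sumsq hm hd hn hs h0]
  constructor
  · apply Multiset.sum_nonneg
    intro a ha
    obtain ⟨b, -, rfl⟩ := Multiset.mem_map.1 ha
    positivity
  intro i
  have := coeff_le_of_roots_le (p := p) (f := RingHom.id ℝ)
    (B := Real.sqrt (p.roots.map (fun r => r ^ 2)).sum) i hm (by simpa using hs) (by
      intro z hz
      rw [Polynomial.map_id] at hz
      rw [Real.norm_eq_abs]
      apply Real.abs_le_sqrt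
      refine Multiset.single_le_sum ?_ _ (Multiset.mem_map_of_mem (fun r => r ^ 2) hz)
      intro a ha
      obtain ⟨b, -, rfl⟩ := Multiset.mem_map.1 ha
      positivity)
  simpa [hd] using this

lemma tendsto_unique_pow {f g : ℝ → ℝ} {x : ℝ} {N : ℕ} (hf : ContinuousAt f x)
    (hg : ContinuousAt g x) (h : ∀ᶠ t in 𝓝 x, (t - x) ^ N * f t = (t - x) ^ N * g t) :
    f x = g x := by
  have h1 : f =ᶠ[𝓝[≠] x] g := by
    filter_upwards [h.filter_mono nhdsWithin_le_nhds, self_mem_nhdsWithin] with t ht hne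
    exact mul_left_cancel₀ (pow_ne_zero _ (sub_ne_zero.2 hne)) ht
  exact tendsto_nhds_unique_of_eventuallyEq (hf.tendsto.mono_left nhdsWithin_le_nhds)
    (hg.tendsto.mono_left nhdsWithin_le_nhds) h1

lemma factor_of_bound {f : ℝ → ℝ} {x : ℝ} {N : ℕ} (hf : AnalyticAt ℝ f x) (K : ℝ)
    (h : ∀ᶠ t in 𝓝 x, |f t| ≤ K * |t - x| ^ N) :
    ∃ g : ℝ → ℝ, AnalyticAt ℝ g x ∧ ∀ᶠ t in 𝓝 x, f t = (t - x) ^ N * g t := by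
  have key : (N : ℕ∞) ≤ analyticOrderAt f x := by
    by_contra hlt
    rw [not_le] at hlt
    obtain ⟨m, hm⟩ := ENat.ne_top_iff_exists.1 (ne_top_of_lt hlt)
    rw [← hm] at hlt
    have hmN : m < N := by exact_mod_cast hlt
    obtain ⟨g, hg, hg0, hfg⟩ := (hf.analyticOrderAt_eq_natCast).1 hm.symm
    apply hg0
    have h1 : ∀ᶠ t in 𝓝[≠] x, |g t| ≤ K * |t - x| ^ (N - m) := by
      filter_upwards [h.filter_mono nhdsWithin_le_nhds, hfg.filter_mono nhdsWithin_le_nhds,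
        self_mem_nhdsWithin] with t ht ht2 hne
      have hpos : 0 < |t - x| ^ m := pow_pos (abs_pos.2 (sub_ne_zero.2 hne)) _
      rw [ht2, smul_eq_mul, abs_mul, abs_pow] at ht
      have e : |t - x| ^ N = |t - x| ^ m * |t - x| ^ (N - m) := by
        rw [← pow_add]; congr 1; omega
      rw [e] at ht
      refine le_of_mul_le_mul_left (a := |t - x| ^ m) ?_ hpos
      linarith
    have h2 : Tendsto (fun t => |g t|) (𝓝[≠] x) (𝓝 |g x|) :=
      (hg.continuousAt.abs.tendsto).mono_left nhdsWithin_le_nhds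
    have h3 : Tendsto (fun t => K * |t - x| ^ (N - m)) (𝓝[≠] x) (𝓝 0) := by
      have : ContinuousAt (fun t => K * |t - x| ^ (N - m)) x := by fun_prop
      have h4 := this.tendsto.mono_left (nhdsWithin_le_nhds (s := {x}ᶜ))
      simpa [show N - m ≠ 0 by omega] using h4
    have := le_of_tendsto_of_tendsto h2 h3 h1
    exact abs_nonpos_iff.1 this
  obtain ⟨g, hg, h⟩ := (natCast_le_analyticOrderAt hf).1 key
  exact ⟨g, hg, by simpa using h⟩

lemma even_order {f : ℝ → ℝ} {x : ℝ} (hf : AnalyticAt ℝ f x) (h0 : ∀ᶠ t in 𝓝 x, 0 ≤ f t)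
    (hne : ¬ ∀ᶠ t in 𝓝 x, f t = 0) : ∃ (r : ℕ) (g : ℝ → ℝ), AnalyticAt ℝ g x ∧ g x ≠ 0 ∧
      ∀ᶠ t in 𝓝 x, f t = (t - x) ^ (2 * r) * g t := by
  obtain ⟨m, g, hg, hg0, hfg⟩ := (hf.exists_eventuallyEq_pow_smul_nonzero_iff).2 hne
  simp only [smul_eq_mul] at hfg
  rcases Nat.even_or_odd m with hm | hm
  · obtain ⟨r, rfl⟩ := hm.two_dvd
    exact ⟨r, g, hg, hg0, hfg⟩
  · exfalso
    apply hg0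
    apply le_antisymm
    · have h1 : ∀ᶠ t in 𝓝[<] x, g t ≤ 0 := by
        filter_upwards [h0.filter_mono nhdsWithin_le_nhds, hfg.filter_mono nhdsWithin_le_nhds,
          self_mem_nhdsWithin] with t ht ht2 hlt
        have : (t - x) ^ m < 0 := hm.pow_neg (sub_neg.2 hlt)
        rw [ht2] at ht
        by_contra hc
        push Not at hc
        linarith [mul_neg_of_neg_of_pos this hc]
      exact le_of_tendsto (hg.continuousAt.tendsto.mono_left nhdsWithin_le_nhds) h1
    · have h1 : ∀ᶠ t in 𝓝[>] x, 0 ≤ g t := by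
        filter_upwards [h0.filter_mono nhdsWithin_le_nhds, hfg.filter_mono nhdsWithin_le_nhds,
          self_mem_nhdsWithin] with t ht ht2 hlt
        have : 0 < (t - x) ^ m := pow_pos (sub_pos.2 hlt) _
        rw [ht2] at ht
        exact nonneg_of_mul_nonneg_right ht this
      exact ge_of_tendsto (hg.continuousAt.tendsto.mono_left nhdsWithin_le_nhds) h1

lemma im_bound {p : ℝ[X]} {n : ℕ} (hm : p.Monic) (hd : p.natDegree = n) (hs : p.Splits) (z : ℂ) :
    |z.im| ^ n ≤ ‖aeval z p‖ := by
  have hcard : p.roots.card = n := by rw [← hs.natDegree_eq_card_roots, hd]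
  rw [hs.eq_prod_roots_of_monic hm, ← hcard]
  generalize p.roots = s
  induction s using Multiset.induction_on with
  | empty => simp
  | cons a s ih =>
    simp only [Multiset.card_cons, Multiset.map_cons, Multiset.prod_cons, map_mul, norm_mul,
      pow_succ']
    refine mul_le_mul ?_ ih (by positivity) (by positivity)
    have := Complex.abs_im_le_norm (z - (a : ℂ))
    simpa using this

lemma splits_limit {Q : ℝ → ℝ[X]} {x : ℝ} {n : ℕ} (hm : ∀ t, (Q t).Monic)
    (hd : ∀ t, (Q t).natDegree = n) (hA : AC Q x) (hs : ∀ᶠ t in 𝓝[≠] x, (Q t).Splits) :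
    (Q x).Splits := by
  have key : ∀ z : ℂ, |z.im| ^ n ≤ ‖aeval z (Q x)‖ := by
    intro z
    have e : (fun t => aeval z (Q t)) =
        fun t => ∑ i ∈ Finset.range (n + 1), (((Q t).coeff i : ℝ) : ℂ) * z ^ i := by
      ext1 t
      rw [aeval_eq_sum_range, hd]
      simp
    have hc : ContinuousAt (fun t => aeval z (Q t)) x := by
      rw [e]
      refine tendsto_finsetSum _ fun i _ => ?_
      refine Tendsto.mul_const _ ?_
      exact (Complex.continuous_ofReal.continuousAt.comp (hA i).continuousAt)
    refine ge_of_tendsto (hc.norm.tendsto.mono_left (nhdsWithin_le_nhds (s := {x}ᶜ))) ?_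
    filter_upwards [hs] with t ht
    exact im_bound (hm t) (hd t) ht z
  refine Splits.of_splits_map (algebraMap ℝ ℂ) (IsAlgClosed.splits _) ?_
  intro z hz
  have hz0 : aeval z (Q x) = 0 := by
    have := (mem_roots'.1 hz).2
    rwa [IsRoot.def, eval_map_algebraMap] at this
  have := key z
  rw [hz0, norm_zero] at this
  have him : z.im = 0 := by
    by_contra h
    have : 0 < |z.im| ^ n := pow_pos (abs_pos.2 h) _
    linarith
  exact ⟨z.re, by apply Complex.ext <;> simp [him]⟩

end Rellich
namespace Rellich
open Filter Topology

def LocalAt (n : ℕ) : Prop := ∀ (P : ℝ → ℝ[X]) (x : ℝ), (∀ t, (P t).Monic) →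
  (∀ t, (P t).natDegree = n) → AC P x → (∀ᶠ t in 𝓝 x, (P t).Splits) →
  ∃ s : Multiset (ℝ → ℝ), (∀ f ∈ s, AnalyticAt ℝ f x) ∧
    ∀ᶠ t in 𝓝 x, P t = (s.map (fun f => X - C (f t))).prod

/-- splitting step -/
lemma local_split {n : ℕ} (ih : ∀ m < n, LocalAt m) (hn : 2 ≤ n) (Q : ℝ → ℝ[X]) (x : ℝ)
    (hm : ∀ t, (Q t).Monic) (hd : ∀ t, (Q t).natDegree = n) (hA : AC Q x)
    (hs : ∀ᶠ t in 𝓝 x, (Q t).Splits) (h1 : (Q x).coeff (n - 1) = 0)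
    (h2 : (Q x).coeff (n - 2) ≠ 0) :
    ∃ s : Multiset (ℝ → ℝ), (∀ f ∈ s, AnalyticAt ℝ f x) ∧
      ∀ᶠ t in 𝓝 x, Q t = (s.map (fun f => X - C (f t))).prod := by
  have hsx := hs.self_of_nhds
  have hne : (Q x) ≠ 0 := (hm x).ne_zero
  obtain ⟨a, ha⟩ := hsx.exists_eval_eq_zero (by
    rw [degree_eq_natDegree hne, hd]; norm_cast; omega)
  obtain ⟨q, hq, hndvd⟩ := exists_eq_pow_rootMultiplicity_mul_and_not_dvd (Q x) hne a
  set k := rootMultiplicity a (Q x) with hk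
  have hk0 : 0 < k := (rootMultiplicity_pos hne).2 ha
  have hpm : ((X - C a) ^ k).Monic := (monic_X_sub_C a).pow k
  have hqm : q.Monic := by
    have := hm x
    rw [hq] at this
    exact hpm.of_mul_monic_left this
  have hpd : ((X - C a) ^ k).natDegree = k := by
    rw [(monic_X_sub_C a).natDegree_pow]; simp
  have hdeg : k + q.natDegree = n := by
    rw [← hd x, hq, hpm.natDegree_mul hqm, hpd]
  have hqd : 0 < q.natDegree := by
    rw [Nat.pos_iff_ne_zero]
    intro h0
    have hq1 : q = 1 := hqm.natDegree_eq_zero.1 h0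
    have hkn : k = n := by omega
    rw [hq1, mul_one, hkn] at hq
    have c1 : (Q x).coeff (n - 1) = (-a) * n := by
      rw [hq, sub_eq_add_neg, ← C_neg, coeff_X_add_C_pow]
      rw [show n - (n - 1) = 1 by omega, Nat.choose_symm (show 1 ≤ n by omega)]
      simp
    have ha0 : a = 0 := by
      rw [h1] at c1
      have : (n : ℝ) ≠ 0 := by norm_cast; omega
      have := (mul_eq_zero.1 c1.symm).resolve_right this
      linarith
    apply h2
    rw [hq, ha0]
    simp only [map_zero, sub_zero, coeff_X_pow]
    rw [if_neg (by omega)]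
  have hcop : IsCoprime ((X - C a) ^ k) q :=
    IsCoprime.pow_left ((irreducible_X_sub_C a).coprime_iff_not_dvd.2 hndvd)
  obtain ⟨U, V, hU, hV, hUd, hVd, hUA, hVA, hUV⟩ := hensel Q x _ q hpm hqm hcop hq hm
    (fun t => by rw [hd, hpd, hdeg]) hA
  have hspl : ∀ᶠ t in 𝓝 x, (U t).Splits ∧ (V t).Splits := by
    filter_upwards [hs, hUV] with t h1 h2
    exact ⟨h1.of_dvd (hm t).ne_zero ⟨_, h2⟩, h1.of_dvd (hm t).ne_zero ⟨U t, by rw [h2, mul_comm]⟩⟩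
  obtain ⟨s1, hs1, he1⟩ := ih k (by omega) U x hU (fun t => by rw [hUd, hpd]) hUA
    (hspl.mono fun t h => h.1)
  obtain ⟨s2, hs2, he2⟩ := ih q.natDegree (by omega) V x hV hVd hVA (hspl.mono fun t h => h.2)
  refine ⟨s1 + s2, ?_, ?_⟩
  · intro f hf
    rcases Multiset.mem_add.1 hf with h | h
    · exact hs1 f h
    · exact hs2 f h
  · filter_upwards [he1, he2, hUV] with t h1 h2 h3
    rw [h3, h1, h2, Multiset.map_add, Multiset.prod_add]

lemma scaleRoots_prod (s : Multiset ℝ) (c : ℝ) :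
    ((s.map (fun a => X - C a)).prod).scaleRoots c = (s.map (fun a => X - C (c * a))).prod := by
  induction s using Multiset.induction_on with
  | empty => simp
  | cons a s ih =>
    simp only [Multiset.map_cons, Multiset.prod_cons, mul_scaleRoots_of_noZeroDivisors, ih,
      X_sub_C_scaleRoots, mul_comm c]

lemma local_centered {n : ℕ} (ih : ∀ m < n, LocalAt m) (hn : 2 ≤ n) (P : ℝ → ℝ[X]) (x : ℝ)
    (hm : ∀ t, (P t).Monic) (hd : ∀ t, (P t).natDegree = n) (hA : AC P x)
    (hs : ∀ᶠ t in 𝓝 x, (P t).Splits) (h0 : ∀ t, (P t).coeff (n - 1) = 0) :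
    ∃ s : Multiset (ℝ → ℝ), (∀ f ∈ s, AnalyticAt ℝ f x) ∧
      ∀ᶠ t in 𝓝 x, P t = (s.map (fun f => X - C (f t))).prod := by
  set f : ℝ → ℝ := fun t => -2 * (P t).coeff (n - 2) with hf
  have hfA : AnalyticAt ℝ f x := analyticAt_const.mul (hA _)
  have hb : ∀ᶠ t in 𝓝 x, 0 ≤ f t ∧ ∀ i, |(P t).coeff i| ≤ Real.sqrt (f t) ^ (n - i) * n.choose i := by
    filter_upwards [hs] with t ht
    exact coeff_bound (hm t) (hd t) hn ht (h0 t)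
  by_cases hz : ∀ᶠ t in 𝓝 x, f t = 0
  · refine ⟨Multiset.replicate n 0, ?_, ?_⟩
    · intro g hg
      rw [Multiset.eq_of_mem_replicate hg]
      exact analyticAt_const
    · filter_upwards [hz, hb] with t h1 h2
      have : ofP n (P t) = 0 := by
        ext i
        have := h2.2 i
        rw [h1, Real.sqrt_zero, zero_pow (by have := i.2; omega), zero_mul] at this
        simpa [ofP] using this
      rw [← X_pow_add_ofP n (P t) (hm t) (hd t), this]
      simp
  obtain ⟨r, g, hg, hg0, hfg⟩ := even_order hfA (hb.mono fun t h => h.1) hz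
  have hbi : ∀ i : Fin n, ∃ b : ℝ → ℝ, AnalyticAt ℝ b x ∧
      ∀ᶠ t in 𝓝 x, (P t).coeff i = (t - x) ^ (r * (n - i)) * b t := by
    intro i
    have hgb : ∀ᶠ t in 𝓝 x, |g t| ≤ |g x| + 1 := by
      have := hg.continuousAt.abs.tendsto
      exact (this.eventually (gt_mem_nhds (lt_add_one _))).mono fun t h => h.le
    refine factor_of_bound (hA i) (Real.sqrt (|g x| + 1) ^ (n - i : ℕ) * n.choose i) ?_
    filter_upwards [hb, hfg, hgb] with t h1 h2 h3
    refine (h1.2 i).trans ?_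
    have h4 : Real.sqrt (f t) ≤ Real.sqrt (|g x| + 1) * |t - x| ^ r := by
      rw [h2]
      apply Real.sqrt_le_iff.2 ⟨by positivity, ?_⟩
      rw [mul_pow, Real.sq_sqrt (by positivity), ← pow_mul, mul_comm r 2, pow_mul, pow_mul, sq_abs,
        mul_comm]
      exact mul_le_mul_of_nonneg_right ((le_abs_self _).trans h3) (by positivity)
    calc Real.sqrt (f t) ^ (n - i : ℕ) * n.choose i
        ≤ (Real.sqrt (|g x| + 1) * |t - x| ^ r) ^ (n - i : ℕ) * n.choose i := by gcongr
      _ = _ := by rw [mul_pow, ← pow_mul]; ring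
  choose b hbA hbe using hbi
  have hbe' : ∀ᶠ t in 𝓝 x, ∀ i : Fin n, (P t).coeff i = (t - x) ^ (r * (n - i)) * b i t :=
    eventually_all.2 hbe
  set Q : ℝ → ℝ[X] := fun t => X ^ n + toP n (fun i => b i t) with hQ
  have hQm : ∀ t, (Q t).Monic := fun t => monic_X_pow_add' _ _
  have hQd : ∀ t, (Q t).natDegree = n := fun t => natDegree_X_pow_add' _ _
  have hQA : AC Q x := AC_toP (AnalyticAt.pi hbA)
  have hQc : ∀ t (i : Fin n), (Q t).coeff i = b i t := by
    intro t i
    have := i.2.ne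
    simp [hQ, toP_coeff, coeff_X_pow, this]
  have hPQ : ∀ᶠ t in 𝓝 x, P t = (Q t).scaleRoots ((t - x) ^ r) := by
    filter_upwards [hbe'] with t ht
    ext i
    rw [coeff_scaleRoots, hQd]
    rcases lt_trichotomy i n with h | h | h
    · have e := hQc t ⟨i, h⟩
      have e2 := ht ⟨i, h⟩
      simp only at e e2
      rw [e, e2, ← pow_mul, mul_comm]
    · subst h
      have e1 := (hm t).coeff_natDegree
      have e2 := (hQm t).coeff_natDegree
      rw [hd] at e1
      rw [hQd] at e2
      simp [e1, e2]
    · rw [coeff_eq_zero_of_natDegree_lt (by rw [hd]; exact h),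
        coeff_eq_zero_of_natDegree_lt (by rw [hQd]; exact h), zero_mul]
  have hQs' : ∀ᶠ t in 𝓝[≠] x, (Q t).Splits := by
    filter_upwards [hPQ.filter_mono nhdsWithin_le_nhds, hs.filter_mono nhdsWithin_le_nhds,
      self_mem_nhdsWithin] with t h1 h2 hne
    have hne' : (t - x) ^ r ≠ 0 := pow_ne_zero _ (sub_ne_zero.2 hne)
    have : Q t = (P t).scaleRoots ((t - x) ^ r)⁻¹ := by
      rw [h1, ← scaleRoots_mul, mul_inv_cancel₀ hne', scaleRoots_one]
    rw [this]
    exact h2.scaleRoots _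
  have hQsx := splits_limit hQm hQd hQA hQs'
  have hQs : ∀ᶠ t in 𝓝 x, (Q t).Splits := by
    rw [eventually_nhdsWithin_iff] at hQs'
    filter_upwards [hQs'] with t ht
    by_cases h : t = x
    · rw [h]; exact hQsx
    · exact ht h
  have c1 : (Q x).coeff (n - 1) = 0 := by
    have e := hQc x ⟨n - 1, by omega⟩
    simp only at e
    rw [e]
    refine tendsto_unique_pow (N := r * (n - (n - 1))) (g := fun _ => 0) (hbA _).continuousAt
      continuousAt_const ?_
    filter_upwards [hbe'] with t ht
    have := ht ⟨n - 1, by omega⟩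
    simp only [h0] at this
    rw [← this, mul_zero]
  have c2 : (Q x).coeff (n - 2) ≠ 0 := by
    have e := hQc x ⟨n - 2, by omega⟩
    simp only at e
    rw [e]
    have : -2 * b ⟨n - 2, by omega⟩ x = g x := by
      refine tendsto_unique_pow (N := 2 * r) (f := fun t => -2 * b ⟨n - 2, by omega⟩ t)
        (continuousAt_const.mul (hbA _).continuousAt) hg.continuousAt ?_
      filter_upwards [hbe', hfg] with t h1 h2
      have h3 := h1 ⟨n - 2, by omega⟩
      rw [← h2, hf]
      simp only at h3 ⊢
      rw [h3, show n - (n - 2) = 2 by omega, mul_comm r 2]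
      ring
    intro h
    rw [h] at this
    apply hg0
    rw [← this]; ring
  obtain ⟨s, hsA, hse⟩ := local_split ih hn Q x hQm hQd hQA hQs c1 c2
  refine ⟨s.map (fun f t => (t - x) ^ r * f t), ?_, ?_⟩
  · intro f hf
    obtain ⟨f', hf', rfl⟩ := Multiset.mem_map.1 hf
    exact ((analyticAt_id.sub analyticAt_const).pow r).mul (hsA f' hf')
  · filter_upwards [hPQ, hse] with t h1 h2
    have e : (s.map (fun f => X - C (f t))) = (s.map (fun f => f t)).map (fun a => X - C a) := by
      rw [Multiset.map_map]; rfl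
    rw [h1, h2, e, scaleRoots_prod, Multiset.map_map, Multiset.map_map]
    rfl

lemma coeff_comp_shift {p : ℝ[X]} {n : ℕ} (hm : p.Monic) (hd : p.natDegree = n) (hn : 1 ≤ n)
    (c : ℝ) : (p.comp (X + C c)).coeff (n - 1) = p.coeff (n - 1) + n * c := by
  obtain ⟨m, rfl⟩ : ∃ m, n = m + 1 := ⟨n - 1, by omega⟩
  have hl := hm.coeff_natDegree
  rw [hd] at hl
  rw [Polynomial.comp, eval₂_eq_sum_range, hd, Finset.sum_range_succ, Finset.sum_range_succ,
    coeff_add, coeff_add, finsetSum_coeff, Finset.sum_eq_zero]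
  · simp only [coeff_C_mul, coeff_X_add_C_pow, hl]
    simp
    ring
  · intro i hi
    rw [coeff_C_mul, coeff_X_add_C_pow, Nat.choose_eq_zero_of_lt (by simpa using hi)]
    simp

theorem local_all (n : ℕ) : LocalAt n := by
  induction n using Nat.strong_induction_on with
  | _ n ih =>
  intro P x hm hd hA hs
  rcases Nat.lt_or_ge n 2 with hn | hn
  · interval_cases n
    · exact ⟨0, by simp, Eventually.of_forall fun t => by
        simpa using (hm t).natDegree_eq_zero.1 (hd t)⟩
    · refine ⟨{fun t => -(P t).coeff 0}, ?_, Eventually.of_forall fun t => ?_⟩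
      · intro f hf
        rw [Multiset.mem_singleton.1 hf]
        exact (hA 0).neg
      · have := (hm t).eq_X_add_C (hd t)
        simpa using this
  set c : ℝ → ℝ := fun t => - (P t).coeff (n - 1) / n with hc
  have hcA : AnalyticAt ℝ c x := (hA _).neg.div_const
  have hn0 : (n : ℝ) ≠ 0 := by norm_cast; omega
  have hdX : ∀ a : ℝ, (X + C a).natDegree = 1 := fun a => natDegree_X_add_C a
  have hm' : ∀ t, ((P t).comp (X + C (c t))).Monic := fun t => (hm t).comp_X_add_C _
  have hd' : ∀ t, ((P t).comp (X + C (c t))).natDegree = n := fun t => by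
    rw [natDegree_comp, hd, hdX, mul_one]
  obtain ⟨s, hsA, hse⟩ := local_centered ih hn (fun t => (P t).comp (X + C (c t))) x hm' hd'
    (AC_comp hA hd hcA) (hs.mono fun t h => h.comp_X_add_C _) (by
      intro t
      rw [coeff_comp_shift (hm t) (hd t) (by omega), hc]
      field_simp
      ring)
  refine ⟨s.map (fun f t => f t + c t), ?_, ?_⟩
  · intro f hf
    obtain ⟨f', hf', rfl⟩ := Multiset.mem_map.1 hf
    exact (hsA f' hf').add hcA
  · filter_upwards [hse] with t ht
    have : P t = ((P t).comp (X + C (c t))).comp (X - C (c t)) := by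
      rw [comp_assoc]; simp
    rw [this, ht, multiset_prod_comp, Multiset.map_map, Multiset.map_map]
    congr 1
    refine Multiset.map_congr rfl fun f _ => ?_
    simp [sub_sub, add_comm]

end Rellich
namespace Rellich
open Filter Topology

lemma exists_perm {n : ℕ} (f g : Fin n → ℝ)
    (h : (∏ j, (X - C (f j)) : ℝ[X]) = ∏ j, (X - C (g j))) :
    ∃ σ : Equiv.Perm (Fin n), ∀ j, f j = g (σ j) := by
  have hr : ∀ f : Fin n → ℝ, (∏ j, (X - C (f j)) : ℝ[X]).roots = Multiset.map f Finset.univ.val := by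
    intro f
    have : (∏ j, (X - C (f j)) : ℝ[X]) =
        ((Multiset.map f Finset.univ.val).map (fun a => X - C a)).prod := by
      rw [Multiset.map_map]; rfl
    rw [this, roots_multiset_prod_X_sub_C]
  have h1 : Multiset.map f Finset.univ.val = Multiset.map g Finset.univ.val := by
    rw [← hr, ← hr, h]
  have hl : ∀ f : Fin n → ℝ, Multiset.map f Finset.univ.val = (List.ofFn f : Multiset ℝ) := by
    intro f; simp [List.ofFn_eq_map]
  have h2 : (List.ofFn f).Perm (List.ofFn g) := by
    rw [← Multiset.coe_eq_coe, ← hl, ← hl, h1]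
  have h3 : f ∘ Tuple.sort f = g ∘ Tuple.sort g := by
    apply List.ofFn_injective
    refine List.Perm.eq_of_pairwise' (r := (· ≤ ·)) (Tuple.monotone_sort f).sortedLE_ofFn.pairwise
      (Tuple.monotone_sort g).sortedLE_ofFn.pairwise ?_
    exact ((Tuple.sort f).ofFn_comp_perm f).trans (h2.trans ((Tuple.sort g).ofFn_comp_perm g).symm)
  refine ⟨(Tuple.sort f).symm.trans (Tuple.sort g), fun j => ?_⟩
  have := congrFun h3 ((Tuple.sort f).symm j)
  simpa using this

def Sys {n : ℕ} (P : ℝ → ℝ[X]) (x : ℝ) (L : Fin n → ℝ → ℝ) : Prop :=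
  (∀ j, AnalyticAt ℝ (L j) x) ∧ ∀ᶠ t in 𝓝 x, P t = ∏ j, (X - C (L j t))

variable {n : ℕ} {P : ℝ → ℝ[X]}

lemma exists_sys {x : ℝ} (hm : ∀ t, (P t).Monic) (hd : ∀ t, (P t).natDegree = n) (hA : AC P x)
    (hs : ∀ t, (P t).Splits) : ∃ L : Fin n → ℝ → ℝ, Sys P x L := by
  obtain ⟨s, hsA, hse⟩ := local_all n P x hm hd hA (Eventually.of_forall hs)
  obtain ⟨l, rfl⟩ := Quot.exists_rep s
  have hl : l.length = n := by
    rw [← hd x, hse.self_of_nhds]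
    have := natDegree_multiset_prod_X_sub_C_eq_card ((l : Multiset (ℝ → ℝ)).map (fun f => f x))
    rw [Multiset.map_map] at this
    simpa using this.symm
  subst hl
  refine ⟨fun j => l[j.1], fun j => hsA _ (by simp), ?_⟩
  filter_upwards [hse] with t ht
  rw [ht, Fin.prod_univ_fun_getElem l (fun f => X - C (f t))]
  simp

lemma Sys.congr {x : ℝ} {L M : Fin n → ℝ → ℝ} (h : Sys P x L) (hLM : ∀ j, L j =ᶠ[𝓝 x] M j) :
    Sys P x M := by
  refine ⟨fun j => (h.1 j).congr (hLM j), ?_⟩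
  filter_upwards [h.2, eventually_all.2 hLM] with t h1 h2
  rw [h1]
  exact Finset.prod_congr rfl fun j _ => by rw [h2]

lemma Sys.perm {x : ℝ} {L : Fin n → ℝ → ℝ} (h : Sys P x L) (σ : Equiv.Perm (Fin n)) :
    Sys P x (fun j => L (σ j)) := by
  refine ⟨fun j => h.1 _, ?_⟩
  filter_upwards [h.2] with t ht
  rw [ht]
  exact (Equiv.prod_comp σ (fun j => X - C (L j t))).symm

lemma Sys.eventually {x : ℝ} {L : Fin n → ℝ → ℝ} (h : Sys P x L) : ∀ᶠ y in 𝓝 x, Sys P y L := by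
  filter_upwards [eventually_all.2 fun j => (h.1 j).eventually_analyticAt,
    eventually_eventually_nhds.2 h.2] with y h1 h2
  exact ⟨h1, h2⟩

lemma Sys.unique {x : ℝ} {L M : Fin n → ℝ → ℝ} (hL : Sys P x L) (hM : Sys P x M) :
    ∃ σ : Equiv.Perm (Fin n), ∀ j, L j =ᶠ[𝓝 x] M (σ j) := by
  have h1 : ∀ᶠ t in 𝓝[≠] x, ∃ σ : Equiv.Perm (Fin n), ∀ j, L j t = M (σ j) t := by
    filter_upwards [hL.2.filter_mono nhdsWithin_le_nhds, hM.2.filter_mono nhdsWithin_le_nhds]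
      with t h1 h2
    exact exists_perm (fun j => L j t) (fun j => M j t) (h1.symm.trans h2)
  obtain ⟨σ, hσ⟩ : ∃ σ : Equiv.Perm (Fin n), ∃ᶠ t in 𝓝[≠] x, ∀ j, L j t = M (σ j) t := by
    by_contra hc
    have h2 := eventually_all.2 fun σ => not_frequently.1 (not_exists.1 hc σ)
    obtain ⟨t, ⟨σ, ht⟩, h3⟩ := (h1.and h2).exists
    exact h3 σ ht
  exact ⟨σ, fun j => ((hL.1 j).frequently_eq_iff_eventually_eq (hM.1 (σ j))).1
    (hσ.mono fun t h => h j)⟩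

def Good (n : ℕ) (P : ℝ → ℝ[X]) (a b : ℝ) : Prop :=
  ∃ L : Fin n → ℝ → ℝ, ∀ x ∈ Set.Icc a b, Sys P x L

lemma Good.glue {a b c : ℝ} (hab : a ≤ b) (hbc : b ≤ c) (h1 : Good n P a b) (h2 : Good n P b c) :
    Good n P a c := by
  obtain ⟨L, hL⟩ := h1
  obtain ⟨M, hM⟩ := h2
  obtain ⟨σ, hσ⟩ := (hL b ⟨hab, le_rfl⟩).unique (hM b ⟨le_rfl, hbc⟩)
  refine ⟨fun j t => if t ≤ b then L j t else M (σ j) t, fun x hx => ?_⟩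
  rcases lt_trichotomy x b with h | h | h
  · refine (hL x ⟨hx.1, h.le⟩).congr fun j => ?_
    filter_upwards [gt_mem_nhds h] with t ht
    simp [le_of_lt ht]
  · subst h
    refine (hL x ⟨hab, le_rfl⟩).congr fun j => ?_
    filter_upwards [hσ j] with t ht
    simp [← ht]
  · refine ((hM x ⟨h.le, hx.2⟩).perm σ).congr fun j => ?_
    filter_upwards [lt_mem_nhds h] with t ht
    simp [not_le.2 ht]

lemma good_all (hloc : ∀ x, ∃ L : Fin n → ℝ → ℝ, Sys P x L) {a b : ℝ} (hab : a ≤ b) :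
    Good n P a b := by
  choose L hL using hloc
  obtain ⟨t, ht0, htm, ⟨m, hmb⟩, hsub⟩ := exists_monotone_Icc_subset_open_cover_Icc hab
    (c := fun y : ℝ => {z : Set.Icc a b | ∀ᶠ w in 𝓝 (z : ℝ), Sys P w (L y)})
    (fun y => (isOpen_setOfPred_eventually_nhds (p := fun w => Sys P w (L y))).preimage continuous_subtype_val)
    (fun z _ => Set.mem_iUnion.2 ⟨z, (hL z).eventually⟩)
  have key : ∀ k, Good n P a (t k) := by
    intro k
    induction k with
    | zero =>
      rw [ht0]
      refine ⟨L a, fun x hx => ?_⟩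
      have : x = a := le_antisymm hx.2 hx.1
      rw [this]; exact hL a
    | succ k ih =>
      refine ih.glue (t k).2.1 (htm (Nat.le_succ k)) ?_
      obtain ⟨y, hy⟩ := hsub k
      refine ⟨L y, fun x hx => ?_⟩
      have := hy (a := ⟨x, (t k).2.1.trans hx.1, hx.2.trans (t (k+1)).2.2⟩) ⟨hx.1, hx.2⟩
      have h' : ∀ᶠ w in 𝓝 x, Sys P w (L y) := this
      exact h'.self_of_nhds
  have := key m
  rwa [hmb m le_rfl] at this

lemma global (hloc : ∀ x, ∃ L : Fin n → ℝ → ℝ, Sys P x L) :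
    ∃ L : Fin n → ℝ → ℝ, ∀ x, Sys P x L := by
  obtain ⟨L0, hL0⟩ := hloc 0
  have h : ∀ N : ℕ, ∃ L : Fin n → ℝ → ℝ, (∀ x ∈ Set.Icc (-(N:ℝ)) N, Sys P x L) ∧
      ∀ j, L0 j =ᶠ[𝓝 0] L j := by
    intro N
    obtain ⟨L, hL⟩ := good_all hloc (a := -(N:ℝ)) (b := N) (by linarith [N.cast_nonneg (α := ℝ)])
    obtain ⟨σ, hσ⟩ := hL0.unique (hL 0 ⟨by simp, by simp⟩)
    exact ⟨fun j => L (σ j), fun x hx => (hL x hx).perm σ, hσ⟩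
  choose F hF hF0 using h
  have agree : ∀ M N : ℕ, M ≤ N → ∀ j, Set.EqOn (F M j) (F N j) (Set.Icc (-(M:ℝ)) M) := by
    intro M N hMN j
    have hc : (M:ℝ) ≤ N := by exact_mod_cast hMN
    refine AnalyticOnNhd.eqOn_of_preconnected_of_eventuallyEq (𝕜 := ℝ)
      (fun x hx => (hF M x hx).1 j)
      (fun x hx => (hF N x ⟨by linarith [hx.1], by linarith [hx.2]⟩).1 j) isPreconnected_Icc
      (z₀ := 0) ⟨by simp, by simp⟩ ((hF0 M j).symm.trans (hF0 N j))
  refine ⟨fun j t => F ⌈|t|⌉₊ j t, fun x => ?_⟩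
  have hx : |x| < (⌈|x|⌉₊ + 1 : ℕ) := by push_cast; linarith [Nat.le_ceil |x|]
  refine (hF (⌈|x|⌉₊ + 1) x (abs_le.1 hx.le)).congr fun j => ?_
  filter_upwards [continuous_abs.continuousAt.eventually (gt_mem_nhds hx)] with t ht
  exact (agree _ _ (Nat.ceil_le.2 ht.le) j (abs_le.1 (Nat.le_ceil |t|))).symm

end Rellich

theorem analytic_arrangement_of_eigenvalues_univariate
    (n : ℕ) (A : ℝ → Matrix (Fin n) (Fin n) ℂ)
    (hAnal : ∀ i j : Fin n, ∀ x : ℝ, AnalyticAt ℝ (fun ω : ℝ => A ω i j) x)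
    (hHerm : ∀ ω : ℝ, (A ω).IsHermitian) :
    ∃ lam : Fin n → ℝ → ℝ,
      (∀ j : Fin n, ∀ x : ℝ, AnalyticAt ℝ (lam j) x) ∧
      (∀ ω : ℝ, (A ω).charpoly = ∏ j : Fin n, (X - C ((lam j ω : ℝ) : ℂ))) := by
  have hmap : ∀ v : Fin n → ℝ, (∏ j, (X - C (v j)) : ℝ[X]).map (algebraMap ℝ ℂ) =
      ∏ j, (X - C ((v j : ℝ) : ℂ)) := by
    intro v
    rw [Polynomial.map_prod]
    simp
  let P : ℝ → ℝ[X] := fun t => ∏ j, (X - C ((hHerm t).eigenvalues j))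
  have hP : ∀ t, (P t).map (algebraMap ℝ ℂ) = (A t).charpoly := by
    intro t
    rw [(hHerm t).charpoly_eq]
    exact hmap _
  have hm : ∀ t, (P t).Monic := fun t => monic_prod_X_sub_C _ _
  have hd : ∀ t, (P t).natDegree = n := fun t => by simp [P]
  have hs : ∀ t, (P t).Splits := fun t => Splits.prod fun i _ => Splits.X_sub_C _
  have hA : ∀ x, Rellich.AC P x := by
    intro x k
    have h1 : Rellich.AC (fun t => (A t).charpoly) x := by
      simp only [Matrix.charpoly, Matrix.det_apply']
      refine Rellich.AC_sum _ fun σ _ => (Rellich.AC_const _).mul (Rellich.AC_prod _ fun i _ => ?_)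
      have : (fun t => (A t).charmatrix (σ i) i) =
          fun t => (if σ i = i then X else 0) + C (-(A t (σ i) i)) := by
        ext1 t
        rw [charmatrix_apply, C_neg, ← sub_eq_add_neg, diagonal_apply]
      rw [this]
      exact (Rellich.AC_const _).add (Rellich.AC_C (hAnal _ _ x).neg)
    have h2 : (fun t => (P t).coeff k) = fun t => Complex.reCLM ((A t).charpoly.coeff k) := by
      ext1 t
      rw [← hP, coeff_map]
      simp
    rw [h2]
    exact (Complex.reCLM.analyticAt _).comp (h1 k)
  obtain ⟨L, hL⟩ := Rellich.global fun x => Rellich.exists_sys hm hd (hA x) hs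
  refine ⟨L, fun j x => (hL x).1 j, fun t => ?_⟩
  rw [← hP, (hL t).2.self_of_nhds, hmap]
end

section
/- Let A : ℝ → ℂ^{n×n} be a Hermitian matrix function depending analytically on ω, and let λ̃₁, …, λ̃ₙ : ℝ → ℝ be an analytic arrangement of the roots of its characteristic polynomial. Then there exist vector-valued functions v₁, …, vₙ : ℝ → ℂⁿ such that for all ω ∈ ℝ and all j: (1) (λ̃ⱼ(ω) I − A(ω)) vⱼ(ω) = 0; (2) ‖vⱼ(ω)‖₂ = 1; (3) vⱼ(ω)* vₖ(ω) = 0 for every k ≠ j; and (4) each entry of every vⱼ is a real-analytic function of ω. -/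
open Polynomial Matrix
open scoped InnerProductSpace

open Filter Topology in
theorem aux_sign (Z : Set ℝ) (hZ : ∀ x : ℝ, ∀ᶠ y in 𝓝[≠] x, y ∉ Z) :
    ∃ s : ℝ → ℝ, (∀ x, s x = 1 ∨ s x = -1) ∧ (∀ z, z ∉ Z → ∀ᶠ y in 𝓝 z, s y = s z) ∧
      (∀ z, z ∈ Z → ∀ᶠ y in 𝓝 z, (z ≤ y → s y = s z) ∧ (y < z → s y = - s z)) := by
  have hfin : ∀ a b : ℝ, (Z ∩ Set.Ioc a b).Finite := by
    intro a b
    have : (Z ∩ Set.Icc a b).Finite := by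
      by_contra hinf
      have hinf : (Z ∩ Set.Icc a b).Infinite := hinf
      obtain ⟨x, -, hx⟩ := hinf.exists_accPt_of_subset_isCompact isCompact_Icc
        Set.inter_subset_right
      rw [accPt_iff_frequently_nhdsNE] at hx
      exact hx ((hZ x).mono fun y hy h => hy h.1)
    exact this.subset (Set.inter_subset_inter_right _ Set.Ioc_subset_Icc_self)
  have hnear : ∀ z, ∃ ε > 0, ∀ y, |y - z| < ε → y ∈ Z → y = z := by
    intro z
    have := hZ z
    rw [eventually_nhdsWithin_iff, Metric.eventually_nhds_iff] at this
    obtain ⟨ε, he, h⟩ := this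
    refine ⟨ε, he, fun y hy hyZ => ?_⟩
    by_contra hne
    exact h (by rwa [Real.dist_eq]) hne hyZ
  let N : ℝ → ℕ := fun x => if 0 ≤ x then (Z ∩ Set.Ioc 0 x).ncard else (Z ∩ Set.Ioc x 0).ncard
  have hN1 : ∀ x, 0 ≤ x → N x = (Z ∩ Set.Ioc 0 x).ncard := fun x hx => if_pos hx
  have hN2 : ∀ x, x ≤ 0 → N x = (Z ∩ Set.Ioc x 0).ncard := by
    intro x hx
    rcases hx.lt_or_eq with h | h
    · exact if_neg (not_le.2 h)
    · subst h; exact if_pos le_rfl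
  -- key
  have key0 : ∀ a b, a ≤ b → (∀ y ∈ Z, ¬ (a < y ∧ y ≤ b)) → N a = N b := by
    intro a b hab h
    rcases le_total 0 a with ha | ha
    · rw [hN1 a ha, hN1 b (ha.trans hab)]
      congr 1; ext y; simp only [Set.mem_inter_iff, Set.mem_Ioc]; have := h y; grind
    · rcases le_total 0 b with hb | hb
      · rw [hN2 a ha, hN1 b hb]
        have e1 : Z ∩ Set.Ioc a 0 = ∅ := by
          ext y; simp only [Set.mem_inter_iff, Set.mem_Ioc, Set.mem_empty_iff_false]; have := h y; grind
        have e2 : Z ∩ Set.Ioc 0 b = ∅ := by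
          ext y; simp only [Set.mem_inter_iff, Set.mem_Ioc, Set.mem_empty_iff_false]; have := h y; grind
        rw [e1, e2]
      · rw [hN2 a ha, hN2 b hb]
        congr 1; ext y; simp only [Set.mem_inter_iff, Set.mem_Ioc]; have := h y; grind
  have key1 : ∀ a b, a < b → b ∈ Z → (0 < b → 0 ≤ a) → (∀ y ∈ Z, (a < y ∧ y ≤ b) → y = b) →
      N a = N b + 1 ∨ N b = N a + 1 := by
    intro a b hab hb hb0 h
    rcases lt_or_ge 0 b with hb1 | hb1
    · right
      rw [hN1 a (hb0 hb1), hN1 b hb1.le, ← Set.ncard_insert_of_notMem (a := b) _ (hfin _ _)]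
      · congr 1; ext y; simp only [Set.mem_inter_iff, Set.mem_Ioc, Set.mem_insert_iff]
        have := h y; have := hb0 hb1; grind
      · simp only [Set.mem_inter_iff, Set.mem_Ioc]; grind
    · left
      rw [hN2 a (hab.le.trans hb1), hN2 b hb1, ← Set.ncard_insert_of_notMem (a := b) _ (hfin _ _)]
      · congr 1; ext y; simp only [Set.mem_inter_iff, Set.mem_Ioc, Set.mem_insert_iff]
        have := h y; grind
      · simp only [Set.mem_inter_iff, Set.mem_Ioc]; grind
  have hright : ∀ z, ∀ᶠ y in 𝓝 z, z ≤ y → N y = N z := by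
    intro z
    obtain ⟨ε, he, h⟩ := hnear z
    filter_upwards [Metric.ball_mem_nhds z he] with y hy hzy
    rw [Metric.mem_ball, Real.dist_eq, abs_lt] at hy
    refine (key0 z y hzy ?_).symm
    rintro t ht ⟨h1, h2⟩
    have := h t (by rw [abs_lt]; constructor <;> linarith) ht
    linarith
  refine ⟨fun x => (-1) ^ N x, fun x => neg_one_pow_eq_or ℝ _, ?_, ?_⟩
  · intro z hz
    obtain ⟨ε, he, h⟩ := hnear z
    filter_upwards [Metric.ball_mem_nhds z he, hright z] with y hy hr
    rcases le_or_gt z y with hzy | hzy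
    · simp only [hr hzy]
    rw [Metric.mem_ball, Real.dist_eq, abs_lt] at hy
    rw [key0 y z hzy.le]
    rintro t ht ⟨h1, h2⟩
    have := h t (by rw [abs_lt]; constructor <;> linarith) ht
    exact hz (this ▸ ht)
  · intro z hz
    obtain ⟨ε, he, h⟩ := hnear z
    have h0 : ∀ᶠ y in 𝓝 z, 0 < z → 0 ≤ y := by
      by_cases h0 : 0 < z
      · filter_upwards [lt_mem_nhds h0] with y hy _ using hy.le
      · exact Eventually.of_forall fun y hy => absurd hy h0
    filter_upwards [Metric.ball_mem_nhds z he, hright z, h0] with y hy hr h0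
    refine ⟨fun h => by simp only [hr h], fun hlt => ?_⟩
    rw [Metric.mem_ball, Real.dist_eq, abs_lt] at hy
    rcases key1 y z hlt hz h0 (fun t ht ⟨h1, h2⟩ => h t (by rw [abs_lt]; constructor <;> linarith) ht) with h | h
    · simp only [h, pow_succ]; ring
    · simp only [h, pow_succ]; ring

open Filter Topology in
open scoped ContDiff in
theorem aux_normalize {E : Type*} [NormedAddCommGroup E] [InnerProductSpace ℂ E] [CompleteSpace E]
    (w : ℝ → E) (hw : ContDiff ℝ ω w) (x0 : ℝ) (h0 : w x0 ≠ 0) :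
    ∃ v : ℝ → E, ContDiff ℝ ω v ∧ (∀ x, ‖v x‖ = 1) ∧
      ∀ x, ∀ᶠ y in 𝓝[≠] x, ∃ c : ℝ, v y = c • w y := by
  have hwA : AnalyticOnNhd ℝ w Set.univ := contDiff_omega_iff_analyticOnNhd.1 hw
  have hloc : ∀ z, ∃ (k : ℕ) (g : ℝ → E), AnalyticAt ℝ g z ∧ g z ≠ 0 ∧
      ∀ᶠ y in 𝓝 z, w y = (y - z) ^ k • g y := by
    intro z
    rw [(hwA z trivial).exists_eventuallyEq_pow_smul_nonzero_iff]
    intro h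
    have : w = fun _ => 0 := hwA.eq_of_eventuallyEq analyticOnNhd_const h
    exact h0 (by rw [this])
  choose k g hg hg0 hev using hloc
  have hk0 : ∀ y, w y ≠ 0 → k y = 0 ∧ g y y = w y := by
    intro y hy
    have h := (hev y).self_of_nhds
    have : k y = 0 := by
      by_contra hk
      rw [sub_self, zero_pow hk, zero_smul] at h
      exact hy h
    rw [this] at h
    exact ⟨this, by simpa using h.symm⟩
  have hgn : ∀ z, ∀ᶠ y in 𝓝 z, g z y ≠ 0 := fun z =>
    (hg z).continuousAt.eventually_ne (hg0 z)
  have hne : ∀ z, ∀ᶠ y in 𝓝[≠] z, w y ≠ 0 := by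
    intro z
    rw [eventually_nhdsWithin_iff]
    filter_upwards [hev z, hgn z] with y h1 h2 h3
    rw [h1]
    exact smul_ne_zero (pow_ne_zero _ (sub_ne_zero.2 h3)) h2
  obtain ⟨s, hs1, hs2, hs3⟩ := aux_sign {z | Odd (k z)} (by
    intro z
    filter_upwards [hne z] with y hy
    simp [(hk0 y hy).1])
  have hnorm : ∀ x, ‖(s x * ‖g x x‖⁻¹) • g x x‖ = 1 := by
    intro x
    rw [norm_smul, norm_mul, norm_inv, norm_norm, mul_assoc, inv_mul_cancel₀ (norm_ne_zero_iff.2 (hg0 x))]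
    rcases hs1 x with h | h <;> simp [h]
  refine ⟨fun x => (s x * ‖g x x‖⁻¹) • g x x, ?_, hnorm, ?_⟩
  · rw [contDiff_iff_contDiffAt]
    intro z
    have hgc : ContDiffAt ℝ ω (g z) z := (hg z).contDiffAt
    have hc : ContDiffAt ℝ ω (fun y => (s z * ‖g z y‖⁻¹) • g z y) z :=
      (contDiffAt_const.mul ((hgc.norm ℂ (hg0 z)).inv (norm_ne_zero_iff.2 (hg0 z)))).smul hgc
    refine hc.congr_of_eventuallyEq ?_
    have hne' := hne z
    rw [eventually_nhdsWithin_iff] at hne'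
    have hs : ∀ᶠ y in 𝓝 z, y ≠ z → s y * (|y - z| ^ k z)⁻¹ * (y - z) ^ k z = s z := by
      by_cases ho : Odd (k z)
      · filter_upwards [hs3 z ho] with y hy hyz
        rcases lt_or_gt_of_ne hyz with h | h
        · rw [hy.2 h, abs_of_neg (sub_neg.2 h), neg_pow, ho.neg_one_pow]
          have : (y - z) ^ k z ≠ 0 := pow_ne_zero _ (sub_ne_zero.2 hyz)
          field_simp
        · rw [hy.1 h.le, abs_of_pos (sub_pos.2 h)]
          have : (y - z) ^ k z ≠ 0 := pow_ne_zero _ (sub_ne_zero.2 hyz)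
          field_simp
      · filter_upwards [hs2 z ho] with y hy hyz
        rw [hy, (Nat.not_odd_iff_even.1 ho).pow_abs]
        have : (y - z) ^ k z ≠ 0 := pow_ne_zero _ (sub_ne_zero.2 hyz)
        field_simp
    filter_upwards [hev z, hne', hs] with y h1 h2 h3
    by_cases hyz : y = z
    · subst hyz; rfl
    · show (s y * ‖g y y‖⁻¹) • g y y = (s z * ‖g z y‖⁻¹) • g z y
      rw [(hk0 y (h2 hyz)).2, h1, norm_smul, norm_pow, Real.norm_eq_abs, smul_smul, ← h3 hyz]
      congr 1
      rw [mul_inv]; ring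
  · intro x
    filter_upwards [hne x] with y hy
    exact ⟨s y * ‖g y y‖⁻¹, by rw [(hk0 y hy).2]⟩

open Filter Topology in
theorem aux_closed {F : Type*} [NormedAddCommGroup F] (f : ℝ → F) (hf : Continuous f)
    (h : ∀ x, ∀ᶠ y in 𝓝[≠] x, f y = 0) (x : ℝ) : f x = 0 := by
  have h1 : Tendsto f (𝓝[≠] x) (𝓝 (f x)) := (hf.tendsto x).mono_left nhdsWithin_le_nhds
  have h2 : Tendsto f (𝓝[≠] x) (𝓝 0) := tendsto_const_nhds.congr' ((h x).mono fun y hy => hy.symm)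
  exact tendsto_nhds_unique h1 h2

theorem aux_perm {n : ℕ} (f g : Fin n → ℂ)
    (h : Multiset.map f Finset.univ.val = Multiset.map g Finset.univ.val) :
    ∃ e : Fin n ≃ Fin n, ∀ i, g (e i) = f i := by
  classical
  have hc : ∀ c, Nonempty ({a // f a = c} ≃ {b // g b = c}) := by
    intro c
    apply Fintype.card_eq.1
    have := congrArg (Multiset.count c) h
    rw [Multiset.count_map, Multiset.count_map] at this
    rw [Fintype.card_subtype, Fintype.card_subtype]
    simpa [Finset.card, Finset.filter, eq_comm] using this
  refine ⟨Equiv.ofFiberEquiv fun c => (hc c).some, fun i => Equiv.ofFiberEquiv_map _ i⟩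

open Filter Topology in
open scoped ContDiff in
theorem aux_step {E : Type*} [NormedAddCommGroup E] [InnerProductSpace ℂ E] [CompleteSpace E]
    (n : ℕ) (T : ℝ → E →ₗ[ℂ] E)
    (hT : ∀ w : ℝ → E, ContDiff ℝ ω w → ContDiff ℝ ω (fun x => T x (w x)))
    (hsym : ∀ x, (T x).IsSymmetric)
    (lam : Fin n → ℝ → ℝ) (hlam : ∀ j, ContDiff ℝ ω (lam j))
    (hb : ∀ x, ∃ b : OrthonormalBasis (Fin n) ℂ E, ∀ j, T x (b j) = (lam j x : ℂ) • b j)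
    (S : Finset (Fin n)) :
    ∃ v : Fin n → ℝ → E, (∀ j ∈ S, ContDiff ℝ ω (v j)) ∧
      (∀ j ∈ S, ∀ x, T x (v j x) = (lam j x : ℂ) • v j x) ∧
      (∀ j ∈ S, ∀ x, ‖v j x‖ = 1) ∧
      (∀ j ∈ S, ∀ k ∈ S, ∀ x, k ≠ j → ⟪v j x, v k x⟫_ℂ = 0) := by
  classical
  induction S using Finset.induction_on with
  | empty => exact ⟨fun _ _ => 0, by simp⟩
  | insert j S hj ih =>
    obtain ⟨v, hv1, hv2, hv3, hv4⟩ := ih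
    have hlamC : ∀ i, ContDiff ℝ ω (fun x => (lam i x : ℂ)) := fun i =>
      Complex.ofRealCLM.contDiff.comp (hlam i)
    -- generic point
    obtain ⟨x0, hx0⟩ : ∃ x0, ∀ k, lam k ≠ lam j → lam k x0 ≠ lam j x0 := by
      have : ∀ᶠ x in 𝓝[≠] (0 : ℝ), ∀ k, lam k ≠ lam j → lam k x ≠ lam j x := by
        rw [eventually_all]
        intro k
        by_cases hk : lam k = lam j
        · simp [hk]
        · have : ∀ᶠ x in 𝓝[≠] (0 : ℝ), lam k x ≠ lam j x := by
            by_contra hcon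
            rw [not_eventually] at hcon
            simp only [not_not] at hcon
            exact hk (AnalyticOnNhd.eq_of_frequently_eq
              (contDiff_omega_iff_analyticOnNhd.1 (hlam k))
              (contDiff_omega_iff_analyticOnNhd.1 (hlam j)) hcon)
          exact this.mono fun x hx _ => hx
      exact this.exists
    -- vector u
    obtain ⟨u, hu0, huT, huv⟩ : ∃ u : E, u ≠ 0 ∧ T x0 u = (lam j x0 : ℂ) • u ∧
        ∀ i ∈ S, lam i = lam j → ⟪v i x0, u⟫_ℂ = 0 := by
      obtain ⟨b, hb⟩ := hb x0
      let g : ({k // lam k = lam j} → ℂ) →ₗ[ℂ] E :=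
        Fintype.linearCombination ℂ (fun k : {k // lam k = lam j} => b k.1)
      let f : ({k // lam k = lam j} → ℂ) →ₗ[ℂ] ({i // i ∈ S ∧ lam i = lam j} → ℂ) :=
        LinearMap.pi fun i => (innerSL ℂ (v i.1 x0)).toLinearMap ∘ₗ g
      have hcard : Module.finrank ℂ ({i // i ∈ S ∧ lam i = lam j} → ℂ) <
          Module.finrank ℂ ({k // lam k = lam j} → ℂ) := by
        rw [Module.finrank_fintype_fun_eq_card, Module.finrank_fintype_fun_eq_card,
          Fintype.card_subtype, Fintype.card_subtype]
        apply Finset.card_lt_card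
        rw [Finset.ssubset_iff_of_subset]
        · exact ⟨j, by simp, by simp [hj]⟩
        · intro i; simp
      obtain ⟨c, hc, hc0⟩ := (Submodule.ne_bot_iff _).1 (LinearMap.ker_ne_bot_of_finrank_lt (f := f) hcard)
      have hgc : g c = ∑ k, c k • b k.1 := by
        simp [g, Fintype.linearCombination_apply]
      refine ⟨g c, ?_, ?_, ?_⟩
      · intro h
        apply hc0
        have hli : LinearIndependent ℂ (fun k : {k // lam k = lam j} => b k.1) :=
          b.orthonormal.linearIndependent.comp _ Subtype.val_injective
        rw [Fintype.linearIndependent_iff] at hli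
        funext k
        exact hli c (hgc ▸ h) k
      · rw [hgc, map_sum, Finset.smul_sum]
        refine Finset.sum_congr rfl fun k _ => ?_
        rw [map_smul, hb, k.2, smul_comm]
      · intro i hi hij
        have := congrFun (LinearMap.mem_ker.1 hc) ⟨i, hi, hij⟩
        simpa [f] using this
    -- R
    have hR : ∀ K : Finset (Fin n), ContDiff ℝ ω (fun x =>
        aeval (T x) (∏ k ∈ K, (X - C (lam k x : ℂ))) u) := by
      intro K
      induction K using Finset.induction_on with
      | empty => simpa using contDiff_const
      | insert k K hk ih =>
        have : (fun x => aeval (T x) (∏ k ∈ insert k K, (X - C (lam k x : ℂ))) u) =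
          fun x => T x (aeval (T x) (∏ k ∈ K, (X - C (lam k x : ℂ))) u) -
            (lam k x : ℂ) • aeval (T x) (∏ k ∈ K, (X - C (lam k x : ℂ))) u := by
          funext x
          rw [Finset.prod_insert hk, map_mul]
          simp [Module.algebraMap_end_apply]
        rw [this]
        exact (hT _ ih).sub ((hlamC k).smul ih)
    let K : Finset (Fin n) := Finset.univ.filter fun k => lam k ≠ lam j
    let R : ℝ → E := fun x => aeval (T x) (∏ k ∈ K, (X - C (lam k x : ℂ))) u
    have hRc : ContDiff ℝ ω R := hR K
    have hRT : ∀ x, T x (R x) = (lam j x : ℂ) • R x := by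
      intro x
      obtain ⟨b, hb⟩ := hb x
      have hz : aeval (T x) ((X - C (lam j x : ℂ)) * ∏ k ∈ K, (X - C (lam k x : ℂ))) = 0 := by
        apply b.toBasis.ext
        intro i
        have hei : Module.End.HasEigenvector (T x) (lam i x : ℂ) (b i) :=
          ⟨Module.End.mem_eigenspace_iff.2 (hb i), b.orthonormal.ne_zero i⟩
        rw [OrthonormalBasis.coe_toBasis, Module.End.aeval_apply_of_hasEigenvector hei]
        by_cases h : lam i = lam j
        · simp [h]
        · have : ∏ k ∈ K, ((lam i x : ℂ) - lam k x) = 0 :=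
            Finset.prod_eq_zero (i := i) (by simp [K, h]) (sub_self _)
          simp [eval_prod, this]
      have := congrArg (fun f => f u) hz
      rw [map_mul] at this
      simpa [Module.algebraMap_end_apply, sub_eq_zero, R] using this
    have horth : ∀ i ∈ S, ∀ x, ((lam i x : ℂ) - lam j x) * ⟪v i x, R x⟫_ℂ = 0 := by
      intro i hi x
      have := hsym x (v i x) (R x)
      rw [hv2 i hi, hRT, inner_smul_left, inner_smul_right, Complex.conj_ofReal] at this
      rw [sub_mul, this, sub_self]
    let w : ℝ → E := fun x => R x - ∑ i ∈ S, ⟪v i x, R x⟫_ℂ • v i x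
    have hwc : ContDiff ℝ ω w :=
      hRc.sub (ContDiff.sum fun i hi => ((hv1 i hi).inner ℂ hRc).smul (hv1 i hi))
    have hwT : ∀ x, T x (w x) = (lam j x : ℂ) • w x := by
      intro x
      simp only [w]
      rw [map_sub, map_sum, hRT, smul_sub, Finset.smul_sum]
      congr 1
      refine Finset.sum_congr rfl fun i hi => ?_
      rw [map_smul, hv2 i hi, smul_smul, smul_smul]
      congr 1
      linear_combination horth i hi x
    have hwv : ∀ i ∈ S, ∀ x, ⟪v i x, w x⟫_ℂ = 0 := by
      intro i hi x
      simp only [w]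
      rw [inner_sub_right, inner_sum, Finset.sum_eq_single_of_mem i hi]
      · rw [inner_smul_right, inner_self_eq_norm_sq_to_K, hv3 i hi]; simp
      · intro k hk hki
        rw [inner_smul_right, hv4 i hi k hk x hki, mul_zero]
    have hw0 : w x0 ≠ 0 := by
      have hRu : R x0 = (∏ k ∈ K, ((lam j x0 : ℂ) - lam k x0)) • u := by
        have hei : Module.End.HasEigenvector (T x0) (lam j x0 : ℂ) u :=
          ⟨Module.End.mem_eigenspace_iff.2 huT, hu0⟩
        simp only [R]
        rw [Module.End.aeval_apply_of_hasEigenvector hei, eval_prod]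
        simp
      have hwR : w x0 = R x0 := by
        simp only [w]
        rw [Finset.sum_eq_zero, sub_zero]
        intro i hi
        by_cases h : lam i = lam j
        · rw [hRu, inner_smul_right, huv i hi h, mul_zero, zero_smul]
        · have h1 := horth i hi x0
          have h2 : ((lam i x0 : ℂ) - lam j x0) ≠ 0 := by
            rw [sub_ne_zero]; exact_mod_cast hx0 i h
          rw [(mul_eq_zero.1 h1).resolve_left h2, zero_smul]
      rw [hwR, hRu]
      refine smul_ne_zero (Finset.prod_ne_zero_iff.2 fun k hk => ?_) hu0
      rw [sub_ne_zero]
      exact_mod_cast (hx0 k (by simpa [K] using hk)).symm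
    obtain ⟨v', hv'1, hv'2, hv'3⟩ := aux_normalize w hwc x0 hw0
    have hv'T : ∀ x, T x (v' x) = (lam j x : ℂ) • v' x := by
      intro x
      rw [← sub_eq_zero]
      refine aux_closed (fun x => T x (v' x) - (lam j x : ℂ) • v' x)
        ((hT _ hv'1).sub ((hlamC j).smul hv'1)).continuous (fun z => ?_) x
      filter_upwards [hv'3 z] with y ⟨c, hc⟩
      rw [hc, ← Complex.coe_smul, map_smul, hwT, smul_comm, sub_self]
    have hv'v : ∀ i ∈ S, ∀ x, ⟪v i x, v' x⟫_ℂ = 0 := by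
      intro i hi x
      refine aux_closed (fun x => ⟪v i x, v' x⟫_ℂ)
        ((hv1 i hi).inner ℂ hv'1).continuous (fun z => ?_) x
      filter_upwards [hv'3 z] with y ⟨c, hc⟩
      rw [hc, ← Complex.coe_smul, inner_smul_right, hwv i hi, mul_zero]
    have hup : ∀ i ∈ S, Function.update v j v' i = v i := fun i hi =>
      Function.update_of_ne (by rintro rfl; exact hj hi) _ _
    refine ⟨Function.update v j v', ?_, ?_, ?_, ?_⟩
    · intro i hi
      rcases Finset.mem_insert.1 hi with rfl | hi
      · simpa using hv'1
      · rw [hup i hi]; exact hv1 i hi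
    · intro i hi
      rcases Finset.mem_insert.1 hi with rfl | hi
      · simpa using hv'T
      · rw [hup i hi]; exact hv2 i hi
    · intro i hi
      rcases Finset.mem_insert.1 hi with rfl | hi
      · simpa using hv'2
      · rw [hup i hi]; exact hv3 i hi
    · intro i hi k hk x hki
      rcases Finset.mem_insert.1 hi with rfl | hi'
      · rcases Finset.mem_insert.1 hk with rfl | hk
        · exact absurd rfl hki
        · rw [hup k hk, Function.update_self, inner_eq_zero_symm]
          exact hv'v k hk x
      · rcases Finset.mem_insert.1 hk with rfl | hk
        · rw [hup i hi', Function.update_self]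
          exact hv'v i hi' x
        · rw [hup i hi', hup k hk]; exact hv4 i hi' k hk x hki

/-- **Rellich's theorem, eigenvector part.** Given a Hermitian matrix function
`A : ℝ → ℂ^{n×n}` with real-analytic entries and an analytic arrangement
`λ̃₁, …, λ̃ₙ` of the roots of its characteristic polynomial, there exist
eigenvector functions `v₁, …, vₙ : ℝ → ℂⁿ` with: (1) `(λ̃ⱼ(ω) I − A(ω)) vⱼ(ω) = 0`,
(2) `‖vⱼ(ω)‖₂ = 1`, (3) `vⱼ(ω)* vₖ(ω) = 0` for `k ≠ j`, and (4) every entry of every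
`vⱼ` is real-analytic in `ω`. -/
theorem analytic_eigenvectors_univariate
    (n : ℕ) (A : ℝ → Matrix (Fin n) (Fin n) ℂ)
    (hAnal : ∀ i j : Fin n, ∀ x : ℝ, AnalyticAt ℝ (fun ω : ℝ => A ω i j) x)
    (hHerm : ∀ ω : ℝ, (A ω).IsHermitian)
    (lam : Fin n → ℝ → ℝ)
    (hlamAnal : ∀ j : Fin n, ∀ x : ℝ, AnalyticAt ℝ (lam j) x)
    (hfact : ∀ ω : ℝ, (A ω).charpoly = ∏ j : Fin n, (X - C ((lam j ω : ℝ) : ℂ))) :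
    ∃ v : Fin n → ℝ → EuclideanSpace ℂ (Fin n),
      (∀ j : Fin n, ∀ ω : ℝ,
          ((lam j ω : ℂ) • (1 : Matrix (Fin n) (Fin n) ℂ) - A ω).mulVec (v j ω) = 0) ∧
      (∀ j : Fin n, ∀ ω : ℝ, ‖v j ω‖ = 1) ∧
      (∀ j k : Fin n, ∀ ω : ℝ, k ≠ j → ⟪v j ω, v k ω⟫_ℂ = 0) ∧
      (∀ j : Fin n, ∀ i : Fin n, ∀ x : ℝ, AnalyticAt ℝ (fun ω : ℝ => v j ω i) x) := by
  have hAc : ∀ i j, ContDiff ℝ (⊤ : WithTop ℕ∞) (fun x => A x i j) := fun i j =>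
    contDiff_omega_iff_analyticOnNhd.2 fun x _ => hAnal i j x
  obtain ⟨v, h1, h2, h3, h4⟩ := aux_step (E := EuclideanSpace ℂ (Fin n)) n
    (fun x => Matrix.toEuclideanLin (A x))
    (by
      intro w hw
      rw [contDiff_piLp]
      rw [contDiff_piLp] at hw
      intro i
      simp only [Matrix.toEuclideanLin, Matrix.toLpLin_apply, Matrix.mulVec, dotProduct]
      exact ContDiff.sum fun j _ => (hAc i j).mul (hw j))
    (fun x => Matrix.isSymmetric_toEuclideanLin_iff.2 (hHerm x))
    lam (fun j => contDiff_omega_iff_analyticOnNhd.2 fun x _ => hlamAnal j x)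
    (by
      intro x
      have hr := (hHerm x).roots_charpoly_eq_eigenvalues
      have hl : (∏ j : Fin n, (X - C ((lam j x : ℝ) : ℂ))).roots =
          Multiset.map (fun j => (lam j x : ℂ)) Finset.univ.val := by
        rw [← Polynomial.roots_multiset_prod_X_sub_C
          (Multiset.map (fun j => (lam j x : ℂ)) Finset.univ.val), Multiset.map_map]
        rfl
      rw [hfact x, hl] at hr
      obtain ⟨e, he⟩ := aux_perm _ _ hr
      refine ⟨(hHerm x).eigenvectorBasis.reindex e.symm, fun j => ?_⟩
      have h := (hHerm x).mulVec_eigenvectorBasis (e j)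
      have he := he j
      simp only [Function.comp] at he
      rw [OrthonormalBasis.reindex_apply, Equiv.symm_symm, Matrix.toEuclideanLin, Matrix.toLpLin_apply, h, ← he]
      rfl)
    Finset.univ
  refine ⟨v, ?_, fun j => h3 j (Finset.mem_univ _), fun j k x hkj => h4 j (Finset.mem_univ _) k (Finset.mem_univ _) x hkj, ?_⟩
  · intro j x
    have := congrArg WithLp.ofLp (h2 j (Finset.mem_univ _) x)
    rw [Matrix.toEuclideanLin, Matrix.toLpLin_apply] at this
    rw [Matrix.sub_mulVec, Matrix.smul_mulVec, Matrix.one_mulVec]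
    rw [sub_eq_zero]
    exact this.symm
  · intro j i x
    have := (contDiff_piLp 2).1 (h1 j (Finset.mem_univ _)) i
    exact contDiff_omega_iff_analyticOnNhd.1 this x trivial
end
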